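/- Assume (φ₀,φ₁) ≢ 0. Then problem (2.1) admits a C^∞ solution V(q,ω,τ) for 0 ≤ τ < τ₀; that is, there exists a smooth function V on ℝ×S¹×[0,τ₀) with supp V ⊆ {q ≤ M}, V(q,ω,0) = F₀(q,ω), and ∂²_{qτ}V − Σ_{i,j=0}^2 (d_ij V + Σ_{k=0}^2 e_ij^k ω̂_k ∂_qV) ω̂_i ω̂_j ∂²_qV = 0. -/

import Mathlib

open Real MeasureTheory Filter Topology Asymptotics

noncomputable section

/-- Partial derivative in the `i`-th coordinate direction on `Fin 3 → ℝ`
(coordinates `y = (t, x₁, x₂)`). -/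
def pd (i : Fin 3) (f : (Fin 3 → ℝ) → ℝ) : (Fin 3 → ℝ) → ℝ :=
  fun y => fderiv ℝ f y (Pi.single i 1)

/-- Radon transform of `v : ℝ² → ℝ` over the line `x · ω = s`, where
`ω = (cos θ, sin θ)`. -/
def radon (v : ℝ × ℝ → ℝ) (s θ : ℝ) : ℝ :=
  ∫ t : ℝ, v (s * Real.cos θ - t * Real.sin θ, s * Real.sin θ + t * Real.cos θ)

/-- `ω̂ = (-1, cos θ, sin θ)`. -/
def omegaHat (θ : ℝ) : Fin 3 → ℝ := ![(-1 : ℝ), Real.cos θ, Real.sin θ]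

/-- The Friedlander radiation field `F₀` associated with the data `(φ₀, φ₁)`. -/
def F0 (φ0 φ1 : ℝ × ℝ → ℝ) (σ θ : ℝ) : ℝ :=
  (1 / (2 * Real.pi * Real.sqrt 2)) *
    ∫ s in Set.Ioi σ,
      (radon φ1 s θ - deriv (fun s' => radon φ0 s' θ) s) / Real.sqrt (s - σ)

/-- `F₁(σ,θ) = (Σ d_ij ω̂_i ω̂_j) ∂_σ F₀(σ,θ)`. -/
def F1 (d : Fin 3 → Fin 3 → ℝ) (φ0 φ1 : ℝ × ℝ → ℝ) (σ θ : ℝ) : ℝ :=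
  (∑ i : Fin 3, ∑ j : Fin 3, d i j * omegaHat θ i * omegaHat θ j) *
    deriv (fun σ' => F0 φ0 φ1 σ' θ) σ

/-- `F₂(σ,θ) = (Σ e_ij^k ω̂_i ω̂_j ω̂_k) ∂²_σ F₀(σ,θ)`. -/
def F2 (e : Fin 3 → Fin 3 → Fin 3 → ℝ) (φ0 φ1 : ℝ × ℝ → ℝ) (σ θ : ℝ) : ℝ :=
  (∑ i : Fin 3, ∑ j : Fin 3, ∑ k : Fin 3,
      e i j k * omegaHat θ i * omegaHat θ j * omegaHat θ k) *
    deriv (fun σ' => deriv (fun σ'' => F0 φ0 φ1 σ'' θ) σ') σ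

/-- `G₀(σ,θ) = (1/F₁) log(1 + F₁/F₂)`. -/
def G0 (d : Fin 3 → Fin 3 → ℝ) (e : Fin 3 → Fin 3 → Fin 3 → ℝ)
    (φ0 φ1 : ℝ × ℝ → ℝ) (σ θ : ℝ) : ℝ :=
  (1 / F1 d φ0 φ1 σ θ) * Real.log (1 + F1 d φ0 φ1 σ θ / F2 e φ0 φ1 σ θ)

/-- The set `A`. -/
def setA (M : ℝ) (d : Fin 3 → Fin 3 → ℝ) (e : Fin 3 → Fin 3 → Fin 3 → ℝ)
    (φ0 φ1 : ℝ × ℝ → ℝ) : Set (ℝ × ℝ) :=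
  {p | p.1 < M ∧ p.2 ∈ Set.Icc 0 (2 * Real.pi) ∧
    F1 d φ0 φ1 p.1 p.2 ≠ 0 ∧ F2 e φ0 φ1 p.1 p.2 ≠ 0 ∧
    0 < 1 + F1 d φ0 φ1 p.1 p.2 / F2 e φ0 φ1 p.1 p.2}

/-- The set `B = {(σ,θ) ∈ A : G₀(σ,θ) > 0}`. -/
def setB (M : ℝ) (d : Fin 3 → Fin 3 → ℝ) (e : Fin 3 → Fin 3 → Fin 3 → ℝ)
    (φ0 φ1 : ℝ × ℝ → ℝ) : Set (ℝ × ℝ) :=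
  {p ∈ setA M d e φ0 φ1 | 0 < G0 d e φ0 φ1 p.1 p.2}

/-- `τ₀ = inf_{(σ,θ) ∈ B} G₀(σ,θ)`. -/
def tau0 (M : ℝ) (d : Fin 3 → Fin 3 → ℝ) (e : Fin 3 → Fin 3 → Fin 3 → ℝ)
    (φ0 φ1 : ℝ × ℝ → ℝ) : ℝ :=
  sInf ((fun p : ℝ × ℝ => G0 d e φ0 φ1 p.1 p.2) '' setB M d e φ0 φ1)

/-- The set `D = {(σ,θ) : σ < M, F₁ = 0, F₂ > 0}`. -/
def setD (M : ℝ) (d : Fin 3 → Fin 3 → ℝ) (e : Fin 3 → Fin 3 → Fin 3 → ℝ)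
    (φ0 φ1 : ℝ × ℝ → ℝ) : Set (ℝ × ℝ) :=
  {p | p.1 < M ∧ p.2 ∈ Set.Icc 0 (2 * Real.pi) ∧
    F1 d φ0 φ1 p.1 p.2 = 0 ∧ 0 < F2 e φ0 φ1 p.1 p.2}

/-- `φ` is supported in the closed disk of radius `M` centered at the origin. -/
def SuppIn (M : ℝ) (φ : ℝ × ℝ → ℝ) : Prop :=
  ∀ x : ℝ × ℝ, M ^ 2 < x.1 ^ 2 + x.2 ^ 2 → φ x = 0

/-- The cubic form `Σ e_ij^k ξ_i ξ_j ξ_k` does not satisfy the null condition: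
it does not vanish identically on the light cone. -/
def NullCondFails (e : Fin 3 → Fin 3 → Fin 3 → ℝ) : Prop :=
  ∃ ξ : Fin 3 → ℝ, ξ 0 ^ 2 = ξ 1 ^ 2 + ξ 2 ^ 2 ∧ (ξ 1 ≠ 0 ∨ ξ 2 ≠ 0) ∧
    (∑ i : Fin 3, ∑ j : Fin 3, ∑ k : Fin 3, e i j k * ξ i * ξ j * ξ k) ≠ 0

/-- Hessian (as a 2×2 matrix) of a function of two real variables. -/
def hessCurried (f : ℝ → ℝ → ℝ) (σ θ : ℝ) : Matrix (Fin 2) (Fin 2) ℝ :=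
  !![deriv (fun a => deriv (fun b => f b θ) a) σ,
     deriv (fun a => deriv (fun b => f a b) θ) σ;
     deriv (fun b => deriv (fun a => f a b) σ) θ,
     deriv (fun b => deriv (fun b' => f σ b') b) θ]

/-- Minkowski coefficients: `Σ c_ij ∂_ij = ∂_t² - Δ`. -/
def cMink : Fin 3 → Fin 3 → ℝ := fun i j =>
  if i = j then (if i = 0 then 1 else -1) else 0

/-- `u` is a `C^∞` solution of problem (1.1) on `[0,T) × ℝ²`. -/
def IsSol (g : Fin 3 → Fin 3 → ℝ → (Fin 3 → ℝ) → ℝ) (ε : ℝ)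
    (φ0 φ1 : ℝ × ℝ → ℝ) (u : (Fin 3 → ℝ) → ℝ) (T : ℝ) : Prop :=
  ContDiffOn ℝ (⊤ : ℕ∞) u {y | 0 ≤ y 0 ∧ y 0 < T} ∧
  (∀ y : Fin 3 → ℝ, 0 ≤ y 0 → y 0 < T →
    ∑ i : Fin 3, ∑ j : Fin 3,
      g i j (u y) (fun k => pd k u y) * pd i (pd j u) y = 0) ∧
  (∀ x : ℝ × ℝ, u ![0, x.1, x.2] = ε * φ0 x ∧ pd 0 u ![0, x.1, x.2] = ε * φ1 x)

/-- The lifespan `T_ε`: the supremum of times of existence of smooth solutions. -/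
def lifespan (g : Fin 3 → Fin 3 → ℝ → (Fin 3 → ℝ) → ℝ) (ε : ℝ)
    (φ0 φ1 : ℝ × ℝ → ℝ) : ℝ :=
  sSup {T : ℝ | ∃ u, IsSol g ε φ0 φ1 u T}

/-- `V` is a `C^∞` solution of the profile problem (2.1) on `ℝ × S¹ × [0, τmax)`. -/
def IsProfileSol (M : ℝ) (d : Fin 3 → Fin 3 → ℝ) (e : Fin 3 → Fin 3 → Fin 3 → ℝ)
    (φ0 φ1 : ℝ × ℝ → ℝ) (τmax : ℝ) (V : ℝ → ℝ → ℝ → ℝ) : Prop :=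
  ContDiffOn ℝ (⊤ : ℕ∞) (fun p : ℝ × ℝ × ℝ => V p.1 p.2.1 p.2.2)
    {p : ℝ × ℝ × ℝ | 0 ≤ p.2.2 ∧ p.2.2 < τmax} ∧
  (∀ q θ τ : ℝ, V q (θ + 2 * Real.pi) τ = V q θ τ) ∧
  (∀ q θ τ : ℝ, M < q → V q θ τ = 0) ∧
  (∀ q θ : ℝ, V q θ 0 = F0 φ0 φ1 q θ) ∧
  (∀ q θ τ : ℝ, 0 ≤ τ → τ < τmax →
    deriv (fun τ' => deriv (fun q' => V q' θ τ') q) τ -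
      ∑ i : Fin 3, ∑ j : Fin 3,
        (d i j * V q θ τ +
          ∑ k : Fin 3, e i j k * omegaHat θ k * deriv (fun q' => V q' θ τ) q) *
        omegaHat θ i * omegaHat θ j *
        deriv (fun q' => deriv (fun q'' => V q'' θ τ) q') q = 0)

/-- The Jacobian `∂_s q` of the characteristic flow. -/
def kfun (d : Fin 3 → Fin 3 → ℝ) (e : Fin 3 → Fin 3 → Fin 3 → ℝ)
    (φ0 φ1 : ℝ × ℝ → ℝ) (ρ θ τ : ℝ) : ℝ :=
  if F1 d φ0 φ1 ρ θ = 0 then 1 - τ * F2 e φ0 φ1 ρ θ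
  else Real.exp (-τ * F1 d φ0 φ1 ρ θ) * (1 + F2 e φ0 φ1 ρ θ / F1 d φ0 φ1 ρ θ)
        - F2 e φ0 φ1 ρ θ / F1 d φ0 φ1 ρ θ

/-- Partial derivatives on `ℝ × ℝ × ℝ` (coordinates `(s, θ, τ)`). -/
def pd3 : Fin 3 → (ℝ × ℝ × ℝ → ℝ) → ℝ × ℝ × ℝ → ℝ :=
  ![fun f p => deriv (fun a => f (a, p.2.1, p.2.2)) p.1,
    fun f p => deriv (fun a => f (p.1, a, p.2.2)) p.2.1,
    fun f p => deriv (fun a => f (p.1, p.2.1, a)) p.2.2]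

/-- Hessian in the first two variables `(s, θ)` of a function on `ℝ × ℝ × ℝ`. -/
def hessST (f : ℝ × ℝ × ℝ → ℝ) (p : ℝ × ℝ × ℝ) : Matrix (Fin 2) (Fin 2) ℝ :=
  !![pd3 0 (pd3 0 f) p, pd3 0 (pd3 1 f) p;
     pd3 1 (pd3 0 f) p, pd3 1 (pd3 1 f) p]

/-- The Klainerman vector fields on `ℝ_t × ℝ²`:
`∂_t, ∂_1, ∂_2, S = t∂_t + x₁∂_1 + x₂∂_2, H₁, H₂, R`. -/
def KOp : Fin 7 → ((Fin 3 → ℝ) → ℝ) → (Fin 3 → ℝ) → ℝ :=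
  ![fun f => pd 0 f,
    fun f => pd 1 f,
    fun f => pd 2 f,
    fun f y => y 0 * pd 0 f y + y 1 * pd 1 f y + y 2 * pd 2 f y,
    fun f y => y 1 * pd 0 f y + y 0 * pd 1 f y,
    fun f y => y 2 * pd 0 f y + y 0 * pd 2 f y,
    fun f y => y 1 * pd 2 f y - y 2 * pd 1 f y]

/-- `Z^α`: iterated product of Klainerman vector fields indexed by a list. -/
def Zpow (α : List (Fin 7)) (f : (Fin 3 → ℝ) → ℝ) : (Fin 3 → ℝ) → ℝ :=
  α.foldr (fun i acc => KOp i acc) f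

end

open Real MeasureTheory Filter Topology Asymptotics

theorem contDiff_congr' {P : Type} [NormedAddCommGroup P] [NormedSpace ℝ P] {f g : P → ℝ}
    (hf : ContDiff ℝ (⊤ : ℕ∞) f) (h : ∀ p, g p = f p) : ContDiff ℝ (⊤ : ℕ∞) g := by
  rwa [show g = f from funext h]

theorem contDiff_conv_param {P : Type} [NormedAddCommGroup P] [NormedSpace ℝ P]
    (f : ℝ → ℝ) (hf : LocallyIntegrable f volume) (R : ℝ)
    (h : P × ℝ → ℝ) (hh : ContDiff ℝ (⊤ : ℕ∞) h) (hs : ∀ p x, R < |x| → h (p, x) = 0) :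
    ContDiff ℝ (⊤ : ℕ∞) (fun q : P × ℝ => ∫ t, f t * h (q.1, q.2 - t)) := by
  have := contDiffOn_convolution_right_with_param (𝕜 := ℝ) (n := ⊤) (μ := (volume : Measure ℝ))
    (f := f) (g := fun p x => h (p, x)) (s := Set.univ) (k := Metric.closedBall 0 R)
    (ContinuousLinearMap.mul ℝ ℝ) isOpen_univ (isCompact_closedBall 0 R)
    (by
      intro p x _ hx
      apply hs
      simpa using hx) hf (by simpa [Function.HasUncurry.uncurry] using hh.contDiffOn)
  rw [Set.univ_prod_univ, contDiffOn_univ] at this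
  simpa [convolution] using this

theorem contDiff_param_integral {P : Type} [NormedAddCommGroup P] [NormedSpace ℝ P]
    (h : P × ℝ → ℝ) (hh : ContDiff ℝ (⊤ : ℕ∞) h) :
    ContDiff ℝ (⊤ : ℕ∞) (fun p : P => ∫ t in (0:ℝ)..1, h (p, t)) := by
  let χ : ContDiffBump (0:ℝ) := ⟨1, 2, by norm_num, by norm_num⟩
  have hχ : ContDiff ℝ (⊤ : ℕ∞) (fun x => χ x) := χ.contDiff
  have h1 := contDiff_conv_param (P := P) (Set.indicator (Set.Ioc 0 1) (fun _ => (1:ℝ)))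
    ((integrable_indicator_iff measurableSet_Ioc).2 (by simp)).locallyIntegrable 2
    (fun q => χ q.2 * h (q.1, - q.2))
    (by
      have : ContDiff ℝ (⊤ : ℕ∞) (fun q : P × ℝ => (q.1, -q.2)) := by fun_prop
      exact (hχ.comp contDiff_snd).mul (hh.comp this))
    (by
      intro p x hx
      have : χ x = 0 := χ.zero_of_le_dist (by simpa using hx.le)
      simp [this])
  have h2 : ContDiff ℝ (⊤ : ℕ∞) (fun p : P => (p, (0:ℝ))) := by fun_prop
  have h3 := h1.comp h2
  convert h3 using 1
  ext p
  simp only [Function.comp]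
  rw [intervalIntegral.integral_of_le zero_le_one, ← integral_indicator measurableSet_Ioc]
  congr 1
  ext t
  by_cases ht : t ∈ Set.Ioc (0:ℝ) 1
  · have : χ (0 - t) = 1 := χ.one_of_mem_closedBall (by
      simp only [zero_sub, Metric.mem_closedBall, dist_zero_right, norm_neg, Real.norm_eq_abs]
      rw [abs_of_pos ht.1]; exact ht.2)
    rw [Set.indicator_of_mem ht, Set.indicator_of_mem ht, this]
    simp
  · rw [Set.indicator_of_notMem ht, Set.indicator_of_notMem ht]; simp

/-- variable endpoint -/
theorem contDiff_param_integral' (M : ℝ) (h : ℝ × ℝ × ℝ → ℝ) (hh : ContDiff ℝ (⊤ : ℕ∞) h) :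
    ContDiff ℝ (⊤ : ℕ∞) (fun p : ℝ × ℝ × ℝ => ∫ t in M..p.1, h (t, p.2)) := by
  have h1 : ContDiff ℝ (⊤ : ℕ∞) (fun x : (ℝ × ℝ × ℝ) × ℝ =>
      (M + (x.1.1 - M) * x.2, x.1.2)) := by fun_prop
  have h2 := contDiff_param_integral _ (hh.comp h1)
  have h3 : ContDiff ℝ (⊤ : ℕ∞) (fun p : ℝ × ℝ × ℝ => p.1 - M) := by fun_prop
  have h4 := h3.mul h2
  refine contDiff_congr' h4 fun p => ?_
  have := intervalIntegral.smul_integral_comp_add_mul (a := 0) (b := 1)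
    (fun t => h (t, p.2)) (p.1 - M) M
  simp only [smul_eq_mul, mul_zero, add_zero, mul_one, add_sub_cancel] at this
  rw [← this]
  rfl

/-- locally integrable kernel -/
theorem locInt_kernel : LocallyIntegrable (fun t : ℝ => (Real.sqrt (-t))⁻¹) volume := by
  have h : ∀ a b : ℝ, IntervalIntegrable (fun t : ℝ => (Real.sqrt (-t))⁻¹) volume a b := by
    have hr : ∀ a b : ℝ, IntervalIntegrable (fun t : ℝ => t ^ (-(1/2):ℝ)) volume a b := fun a b =>
      intervalIntegral.intervalIntegrable_rpow' (by norm_num)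
    have hpos : ∀ a : ℝ, 0 ≤ a →
        IntervalIntegrable (fun t : ℝ => (Real.sqrt t)⁻¹) volume 0 a := by
      intro a ha
      refine (hr 0 a).congr ?_
      intro t ht
      rw [Set.uIoc_of_le ha] at ht
      simp only
      rw [Real.rpow_neg ht.1.le, Real.sqrt_eq_rpow]
    have hneg : ∀ a : ℝ, a ≤ 0 →
        IntervalIntegrable (fun t : ℝ => (Real.sqrt t)⁻¹) volume 0 a := by
      intro a ha
      refine (intervalIntegrable_const (c := (0:ℝ))).congr ?_
      intro t ht
      rw [Set.uIoc_of_ge ha] at ht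
      simp [Real.sqrt_eq_zero_of_nonpos ht.2]
    have hall : ∀ a : ℝ, IntervalIntegrable (fun t : ℝ => (Real.sqrt t)⁻¹) volume 0 a := by
      intro a
      rcases le_total 0 a with h | h
      · exact hpos a h
      · exact hneg a h
    intro a b
    have := (IntervalIntegrable.iff_comp_neg (f := fun t : ℝ => (Real.sqrt t)⁻¹)
      (a := -a) (b := -b)).1 ((hall (-a)).symm.trans (hall (-b)))
    simpa using this
  rw [locallyIntegrable_iff]
  intro k hk
  obtain ⟨R, hR⟩ := hk.isBounded.subset_closedBall 0
  have : IntegrableOn (fun t : ℝ => (Real.sqrt (-t))⁻¹) (Set.Icc (-(|R|+1)) (|R|+1)) volume := by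
    rw [integrableOn_Icc_iff_integrableOn_Ioc,
      ← intervalIntegrable_iff_integrableOn_Ioc_of_le (by linarith [abs_nonneg R])]
    exact h _ _
  refine this.mono_set (hR.trans ?_)
  intro x hx
  simp only [Metric.mem_closedBall, dist_zero_right, Real.norm_eq_abs] at hx
  have := abs_le.1 hx
  have := le_abs_self R
  constructor <;> linarith

theorem contDiff_radon {M : ℝ} (hM : 0 < M) {φ : ℝ × ℝ → ℝ} (hφ : ContDiff ℝ (⊤ : ℕ∞) φ)
    (hs : SuppIn M φ) : ContDiff ℝ (⊤ : ℕ∞) (fun p : ℝ × ℝ => radon φ p.1 p.2) := by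
  have h0 : ContDiff ℝ (⊤ : ℕ∞) (fun q : (ℝ × ℝ) × ℝ =>
    (q.1.1 * Real.cos q.1.2 + q.2 * Real.sin q.1.2,
      q.1.1 * Real.sin q.1.2 - q.2 * Real.cos q.1.2)) := by fun_prop
  have h1 := contDiff_conv_param (P := ℝ × ℝ) (fun _ => 1) (locallyIntegrable_const 1) M _
    (hφ.comp h0) (by
      intro p x hx
      apply hs
      simp only
      have h1 : M ^ 2 < x ^ 2 := by
        rw [← sq_abs x]; exact pow_lt_pow_left₀ hx hM.le (by norm_num)
      have h2 := Real.sin_sq_add_cos_sq p.2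
      nlinarith [sq_nonneg p.1])
  have h2 : ContDiff ℝ (⊤ : ℕ∞) (fun p : ℝ × ℝ => (p, (0:ℝ))) := by fun_prop
  refine contDiff_congr' (h1.comp h2) fun p => ?_
  simp [radon, Function.comp]
  congr 1

theorem radon_supp {M : ℝ} (hM : 0 < M) {φ : ℝ × ℝ → ℝ} (hs : SuppIn M φ) (s θ : ℝ)
    (h : M < |s|) : radon φ s θ = 0 := by
  unfold radon
  convert integral_zero ℝ ℝ with t
  apply hs
  have h1 : M ^ 2 < s ^ 2 := by
    rw [← sq_abs s]; exact pow_lt_pow_left₀ h hM.le (by norm_num)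
  have h2 := Real.sin_sq_add_cos_sq θ
  simp only
  nlinarith [sq_nonneg t]

theorem radon_periodic (φ : ℝ × ℝ → ℝ) (s θ : ℝ) : radon φ s (θ + 2 * π) = radon φ s θ := by
  simp [radon]

/-- Smooth functions of `(θ,s)`, periodic in `θ`, supported in `|s| ≤ M`. -/
structure Good (M : ℝ) (g : ℝ × ℝ → ℝ) : Prop where
  smooth : ContDiff ℝ (⊤ : ℕ∞) g
  per : ∀ θ s, g (θ + 2 * π, s) = g (θ, s)
  supp : ∀ θ s, M < |s| → g (θ, s) = 0

theorem contDiff_deriv_snd {g : ℝ × ℝ → ℝ} (hg : ContDiff ℝ (⊤ : ℕ∞) g) :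
    ContDiff ℝ (⊤ : ℕ∞) (fun p : ℝ × ℝ => deriv (fun s => g (p.1, s)) p.2) := by
  have h1 : ContDiff ℝ (⊤ : ℕ∞) (fun p => fderiv ℝ g p (0, 1)) :=
    (hg.fderiv_right (m := (⊤ : ℕ∞)) (by simp)).clm_apply contDiff_const
  refine contDiff_congr' h1 fun p => ?_
  have h2 : HasDerivAt (fun s : ℝ => (p.1, s)) (0, 1) p.2 :=
    (hasDerivAt_const _ _).prodMk (hasDerivAt_id _)
  exact ((hg.differentiable (by simp) p).hasFDerivAt.comp_hasDerivAt p.2 h2).deriv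

theorem Good.deriv {M : ℝ} {g : ℝ × ℝ → ℝ} (hg : Good M g) :
    Good M (fun p : ℝ × ℝ => deriv (fun s => g (p.1, s)) p.2) where
  smooth := contDiff_deriv_snd hg.smooth
  per := by intro θ s; simp only [hg.per]
  supp := by
    intro θ s h
    simp only
    have : (fun s => g (θ, s)) =ᶠ[𝓝 s] fun _ => 0 := by
      have : ∀ᶠ x in 𝓝 s, M < |x| := (continuous_abs.tendsto s).eventually_const_lt h
      filter_upwards [this] with x hx using hg.supp θ x hx
    rw [this.deriv_eq]; simp

theorem bounded_of_periodic {g : ℝ × ℝ → ℝ} (hc : Continuous g)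
    (per : ∀ θ s, g (θ + 2 * π, s) = g (θ, s)) (a b : ℝ) :
    ∃ C, 0 ≤ C ∧ ∀ θ s, a ≤ s → s ≤ b → |g (θ, s)| ≤ C := by
  obtain ⟨C, hC⟩ := (isCompact_Icc (a := (0:ℝ)) (b := 2 * π)).prod (isCompact_Icc (a := a) (b := b))
    |>.exists_bound_of_continuousOn hc.continuousOn
  refine ⟨max C 0, le_max_right _ _, fun θ s h1 h2 => ?_⟩
  have hp : Function.Periodic (fun θ => g (θ, s)) (2 * π) := fun θ => per θ s
  obtain ⟨y, hy, hy2⟩ := hp.exists_mem_Ico₀ (by positivity) θ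
  rw [hy2]
  exact (hC (y, s) ⟨⟨hy.1, hy.2.le⟩, h1, h2⟩).trans (le_max_left _ _)

theorem Good.bdd {M : ℝ} {g : ℝ × ℝ → ℝ} (hg : Good M g) :
    ∃ C, 0 ≤ C ∧ ∀ θ s, |g (θ, s)| ≤ C := by
  obtain ⟨C, h0, hC⟩ := bounded_of_periodic hg.smooth.continuous hg.per (-M) M
  refine ⟨C, h0, fun θ s => ?_⟩
  by_cases h : |s| ≤ M
  · exact hC θ s (abs_le.1 h).1 (abs_le.1 h).2
  · rw [hg.supp θ s (not_le.1 h)]; simpa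

noncomputable def Hf (g : ℝ × ℝ → ℝ) (σ θ : ℝ) : ℝ := ∫ t, (Real.sqrt (-t))⁻¹ * g (θ, σ - t)

theorem Good.contDiff_Hf {M : ℝ} {g : ℝ × ℝ → ℝ} (hg : Good M g) :
    ContDiff ℝ (⊤ : ℕ∞) (fun p : ℝ × ℝ => Hf g p.1 p.2) := by
  have h1 := contDiff_conv_param _ locInt_kernel M g hg.smooth hg.supp
  exact h1.comp (contDiff_snd.prodMk contDiff_fst : ContDiff ℝ (⊤ : ℕ∞) (fun p : ℝ × ℝ => (p.2, p.1)))

theorem Good.hasDerivAt_Hf {M : ℝ} {g : ℝ × ℝ → ℝ} (hg : Good M g) (σ θ : ℝ) :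
    HasDerivAt (fun σ => Hf g σ θ)
      (Hf (fun p : ℝ × ℝ => _root_.deriv (fun s => g (p.1, s)) p.2) σ θ) σ := by
  have hc : HasCompactSupport (fun s => g (θ, s)) := by
    refine HasCompactSupport.intro (isCompact_closedBall (0:ℝ) M) fun x hx => hg.supp θ x ?_
    simpa using hx
  have h2 : ContDiff ℝ 1 (fun s => g (θ, s)) :=
    (hg.smooth.comp (contDiff_const.prodMk contDiff_id)).of_le (by exact_mod_cast le_top)
  have := HasCompactSupport.hasDerivAt_convolution_right (μ := (volume : Measure ℝ))
    (ContinuousLinearMap.mul ℝ ℝ) locInt_kernel hc h2 σ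
  exact this

theorem Good.Hf_zero {M : ℝ} {g : ℝ × ℝ → ℝ} (hM : 0 < M) (hg : Good M g) (σ θ : ℝ) (h : M < σ) :
    Hf g σ θ = 0 := by
  unfold Hf
  convert integral_zero ℝ ℝ with t
  rcases le_total 0 t with ht | ht
  · rw [Real.sqrt_eq_zero_of_nonpos (by linarith)]; simp
  · rw [hg.supp]; · simp
    rw [abs_of_pos] <;> linarith

theorem Good.Hf_per {M : ℝ} {g : ℝ × ℝ → ℝ} (hg : Good M g) (σ θ : ℝ) :
    Hf g σ (θ + 2 * π) = Hf g σ θ := by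
  simp [Hf, hg.per]

theorem Good.Hf_decay {M : ℝ} {g : ℝ × ℝ → ℝ} (hM : 0 < M) (hg : Good M g) :
    ∀ ε > 0, ∃ S, ∀ σ ≤ S, ∀ θ, |Hf g σ θ| ≤ ε := by
  obtain ⟨C, hC0, hC⟩ := hg.bdd
  intro ε hε
  set A : ℝ := C * (2 * M) / ε with hA
  have hA0 : 0 ≤ A := by positivity
  refine ⟨-M - (A + 1) ^ 2, fun σ hσ θ => ?_⟩
  have hsub : ∫ t in Set.Icc (σ - M) (σ + M), (Real.sqrt (-t))⁻¹ * g (θ, σ - t) = Hf g σ θ := by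
    apply setIntegral_eq_integral_of_forall_compl_eq_zero
    intro t ht
    rw [hg.supp]
    · simp
    · by_contra hcon
      rw [not_lt, abs_le] at hcon
      exact ht ⟨by linarith, by linarith⟩
  rw [← hsub]
  have hb := norm_setIntegral_le_of_norm_le_const (μ := volume) (s := Set.Icc (σ - M) (σ + M))
    (f := fun t => (Real.sqrt (-t))⁻¹ * g (θ, σ - t)) (C := (A + 1)⁻¹ * C) (by simp) (by
      intro t ht
      rw [norm_mul]
      have h1 : A + 1 ≤ Real.sqrt (-t) := Real.le_sqrt_of_sq_le (by linarith [ht.2])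
      have h2 : ‖(Real.sqrt (-t))⁻¹‖ ≤ (A + 1)⁻¹ := by
        rw [norm_inv, Real.norm_of_nonneg (Real.sqrt_nonneg _)]
        exact inv_anti₀ (by linarith) h1
      exact mul_le_mul h2 (hC _ _) (norm_nonneg _) (by positivity))
  rw [Real.norm_eq_abs] at hb
  refine hb.trans ?_
  simp only [measureReal_def, Real.volume_Icc]
  rw [ENNReal.toReal_ofReal (by linarith), inv_mul_eq_div, div_mul_eq_mul_div, div_le_iff₀ (by linarith)]
  have : A * ε = C * (2 * M) := by rw [hA]; field_simp
  nlinarith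

/-- everything we need about the radiation field -/
structure RadField (M : ℝ) (F : ℝ → ℝ → ℝ) : Prop where
  smooth : ContDiff ℝ (⊤ : ℕ∞) (fun p : ℝ × ℝ => F p.1 p.2)
  per : ∀ σ θ, F σ (θ + 2 * π) = F σ θ
  supp : ∀ σ θ, M < σ → F σ θ = 0
  decay1 : ∀ ε > 0, ∃ S, ∀ σ ≤ S, ∀ θ, |deriv (fun s => F s θ) σ| ≤ ε
  decay2 : ∀ ε > 0, ∃ S, ∀ σ ≤ S, ∀ θ, |deriv (fun s' => deriv (fun s => F s θ) s') σ| ≤ ε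

theorem field_F0 {M : ℝ} (hM : 0 < M) {φ0 φ1 : ℝ × ℝ → ℝ}
    (hφ0 : ContDiff ℝ (⊤ : ℕ∞) φ0) (hφ1 : ContDiff ℝ (⊤ : ℕ∞) φ1)
    (hs0 : SuppIn M φ0) (hs1 : SuppIn M φ1) : RadField M (F0 φ0 φ1) := by
  have hsw : ContDiff ℝ (⊤ : ℕ∞) (fun p : ℝ × ℝ => (p.2, p.1)) := by fun_prop
  have g0 : Good M (fun p => radon φ0 p.2 p.1) :=
    ⟨(contDiff_radon hM hφ0 hs0).comp hsw, fun θ s => radon_periodic _ _ _,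
      fun θ s h => radon_supp hM hs0 _ _ h⟩
  have g1 : Good M (fun p => radon φ1 p.2 p.1) :=
    ⟨(contDiff_radon hM hφ1 hs1).comp hsw, fun θ s => radon_periodic _ _ _,
      fun θ s h => radon_supp hM hs1 _ _ h⟩
  have g0' := g0.deriv
  obtain ⟨c, hc⟩ : ∃ c : ℝ, c = 1 / (2 * Real.pi * Real.sqrt 2) := ⟨_, rfl⟩
  have g : Good M (fun p => c * (radon φ1 p.2 p.1 - deriv (fun s' => radon φ0 s' p.1) p.2)) :=
    ⟨contDiff_const.mul (g1.smooth.sub g0'.smooth),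
      fun θ s => by
        have := g1.per θ s; have := g0'.per θ s; simp_all,
      fun θ s h => by
        have := g1.supp θ s h; have := g0'.supp θ s h; simp_all⟩
  have hF : F0 φ0 φ1 = Hf (fun p => c * (radon φ1 p.2 p.1 - deriv (fun s' => radon φ0 s' p.1) p.2)) := by
    funext σ θ
    unfold F0 Hf
    rw [← hc, setIntegral_eq_integral_of_forall_compl_eq_zero,
      ← integral_sub_left_eq_self _ volume σ, ← integral_const_mul]
    · congr 1
      funext t
      rw [sub_sub_cancel_left]
      ring
    · intro t ht
      rw [Real.sqrt_eq_zero_of_nonpos]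
      · simp
      · simpa using ht
  rw [hF]
  have hd : ∀ {g : ℝ × ℝ → ℝ}, Good M g → ∀ θ, deriv (fun s => Hf g s θ) =
      fun s => Hf (fun p : ℝ × ℝ => deriv (fun s => g (p.1, s)) p.2) s θ := by
    intro g hg θ
    funext s
    exact (hg.hasDerivAt_Hf s θ).deriv
  refine ⟨g.contDiff_Hf, g.Hf_per, g.Hf_zero hM, ?_, ?_⟩
  · simp only [hd g]
    exact g.deriv.Hf_decay hM
  · simp only [hd g, hd g.deriv]
    exact g.deriv.deriv.Hf_decay hM

noncomputable def dS (F : ℝ → ℝ → ℝ) (σ θ : ℝ) : ℝ := deriv (fun s => F s θ) σ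

theorem contDiff_dS {F : ℝ → ℝ → ℝ} (hF : ContDiff ℝ (⊤ : ℕ∞) (fun p : ℝ × ℝ => F p.1 p.2)) :
    ContDiff ℝ (⊤ : ℕ∞) (fun p : ℝ × ℝ => dS F p.1 p.2) := by
  have hsw : ContDiff ℝ (⊤ : ℕ∞) (fun p : ℝ × ℝ => (p.2, p.1)) := by fun_prop
  exact (contDiff_deriv_snd (hF.comp hsw)).comp hsw

theorem hasDerivAt_dS {F : ℝ → ℝ → ℝ} (hF : ContDiff ℝ (⊤ : ℕ∞) (fun p : ℝ × ℝ => F p.1 p.2))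
    (σ θ : ℝ) : HasDerivAt (fun s => F s θ) (dS F σ θ) σ := by
  have h1 : ContDiff ℝ (⊤ : ℕ∞) (fun s : ℝ => (s, θ)) := by fun_prop
  exact ((hF.comp h1).differentiable (by simp) σ).hasDerivAt

theorem per_dS {F : ℝ → ℝ → ℝ} (h : ∀ σ θ, F σ (θ + 2 * π) = F σ θ) (σ θ : ℝ) :
    dS F σ (θ + 2 * π) = dS F σ θ := by simp [dS, h]

theorem supp_dS {M : ℝ} {F : ℝ → ℝ → ℝ} (h : ∀ σ θ, M < σ → F σ θ = 0) (σ θ : ℝ) (hσ : M < σ) :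
    dS F σ θ = 0 := by
  have : (fun s => F s θ) =ᶠ[𝓝 σ] fun _ => 0 := by
    filter_upwards [lt_mem_nhds hσ] with x hx using h x θ hx
  rw [dS, this.deriv_eq]; simp

theorem supp_closed {M : ℝ} {F : ℝ → ℝ → ℝ}
    (hF : ContDiff ℝ (⊤ : ℕ∞) (fun p : ℝ × ℝ => F p.1 p.2))
    (h : ∀ σ θ, M < σ → F σ θ = 0) (σ θ : ℝ) (hσ : M ≤ σ) : F σ θ = 0 := by
  have hc : Continuous (fun s => F s θ) := by
    have h1 : ContDiff ℝ (⊤ : ℕ∞) (fun s : ℝ => (s, θ)) := by fun_prop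
    exact (hF.comp h1).continuous
  have h2 : Set.EqOn (fun s => F s θ) (fun _ => 0) (closure (Set.Ioi M)) :=
    Set.EqOn.closure (fun s hs => h s θ hs) hc continuous_const
  rw [closure_Ioi] at h2
  exact h2 hσ

noncomputable def Ef (x : ℝ) : ℝ := ∫ u in (0:ℝ)..1, Real.exp (-(x * u))

theorem contDiff_Ef : ContDiff ℝ (⊤ : ℕ∞) Ef := by
  have : ContDiff ℝ (⊤ : ℕ∞) (fun p : ℝ × ℝ => Real.exp (-(p.1 * p.2))) := by fun_prop
  exact contDiff_param_integral _ this

theorem mul_Ef (x : ℝ) : x * Ef x = 1 - Real.exp (-x) := by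
  have h := intervalIntegral.integral_eq_sub_of_hasDerivAt (a := 0) (b := 1)
    (f := fun u => -Real.exp (-(x * u))) (f' := fun u => x * Real.exp (-(x * u)))
    (by
      intro u _
      have h1 : HasDerivAt (fun u : ℝ => -(x * u)) (-(x * 1)) u :=
        ((hasDerivAt_id u).const_mul x).neg
      exact h1.exp.neg.congr_deriv (by ring))
    (by apply Continuous.intervalIntegrable; fun_prop)
  rw [intervalIntegral.integral_const_mul] at h
  rw [Ef, h]; simp; ring

theorem Ef_zero : Ef 0 = 1 := by simp [Ef]

theorem Ef_le {x : ℝ} (hx : |x| ≤ 1 / 8) : |Ef x| ≤ 3 := by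
  have := intervalIntegral.norm_integral_le_of_norm_le_const (a := 0) (b := 1) (C := 3)
    (f := fun u => Real.exp (-(x * u))) (by
      intro u hu
      rw [Set.uIoc_of_le zero_le_one] at hu
      rw [Real.norm_of_nonneg (Real.exp_pos _).le]
      have h1 : -(x * u) ≤ 1 := by
        have := abs_le.1 hx
        nlinarith [hu.1, hu.2]
      linarith [Real.exp_le_exp.2 h1, Real.exp_one_lt_d9])
  simpa [Ef] using this

noncomputable def Kf (f1 f2 : ℝ → ℝ → ℝ) (s θ τ : ℝ) : ℝ :=
  Real.exp (-(τ * f1 s θ)) - f2 s θ * (τ * Ef (τ * f1 s θ))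

theorem hasDerivAt_tEf (c τ : ℝ) :
    HasDerivAt (fun τ => τ * Ef (τ * c)) (Real.exp (-(τ * c))) τ := by
  by_cases hc : c = 0
  · subst hc
    simp only [mul_zero, Ef_zero, neg_zero, Real.exp_zero, mul_one]
    exact hasDerivAt_id τ
  · have h : (fun τ => τ * Ef (τ * c)) = fun τ => (1 - Real.exp (-(τ * c))) / c := by
      funext τ
      rw [← mul_Ef]; field_simp
    rw [h]
    have h1 : HasDerivAt (fun τ : ℝ => -(τ * c)) (-(1 * c)) τ :=
      ((hasDerivAt_id τ).mul_const c).neg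
    refine ((h1.exp.const_sub 1).div_const c).congr_deriv ?_
    field_simp

theorem hasDerivAt_Kf (f1 f2 : ℝ → ℝ → ℝ) (s θ τ : ℝ) :
    HasDerivAt (fun τ => Kf f1 f2 s θ τ) (-(f1 s θ * Kf f1 f2 s θ τ + f2 s θ)) τ := by
  have h1 : HasDerivAt (fun τ : ℝ => -(τ * f1 s θ)) (-(1 * f1 s θ)) τ :=
    ((hasDerivAt_id τ).mul_const _).neg
  have h2 := h1.exp.sub ((hasDerivAt_tEf (f1 s θ) τ).const_mul (f2 s θ))
  refine h2.congr_deriv ?_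
  have h3 := mul_Ef (τ * f1 s θ)
  unfold Kf
  linear_combination (-f2 s θ) * h3

theorem Kf_zero (f1 f2 : ℝ → ℝ → ℝ) (s θ : ℝ) : Kf f1 f2 s θ 0 = 1 := by simp [Kf]

theorem Kf_ge {f1 f2 : ℝ → ℝ → ℝ} {s θ τ : ℝ} (h1 : |τ * f1 s θ| ≤ 1 / 8)
    (h2 : |τ * f2 s θ| ≤ 1 / 8) : 1 / 2 ≤ Kf f1 f2 s θ τ := by
  have h3 := Real.add_one_le_exp (-(τ * f1 s θ))
  have h4 := abs_le.1 h1
  have h5 : |f2 s θ * (τ * Ef (τ * f1 s θ))| ≤ 1 / 8 * 3 := by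
    rw [show f2 s θ * (τ * Ef (τ * f1 s θ)) = (τ * f2 s θ) * Ef (τ * f1 s θ) by ring, abs_mul]
    exact mul_le_mul h2 (Ef_le h1) (abs_nonneg _) (by norm_num)
  have h6 := abs_le.1 h5
  unfold Kf
  linarith [h6.2, h4.2]

theorem contDiff_Kf {f1 f2 : ℝ → ℝ → ℝ}
    (h1 : ContDiff ℝ (⊤ : ℕ∞) (fun p : ℝ × ℝ => f1 p.1 p.2))
    (h2 : ContDiff ℝ (⊤ : ℕ∞) (fun p : ℝ × ℝ => f2 p.1 p.2)) :
    ContDiff ℝ (⊤ : ℕ∞) (fun p : ℝ × ℝ × ℝ => Kf f1 f2 p.1 p.2.1 p.2.2) := by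
  have hp : ContDiff ℝ (⊤ : ℕ∞) (fun p : ℝ × ℝ × ℝ => (p.1, p.2.1)) := by fun_prop
  have ht : ContDiff ℝ (⊤ : ℕ∞) (fun p : ℝ × ℝ × ℝ => p.2.2) := by fun_prop
  have h1' := ht.mul (h1.comp hp)
  exact h1'.neg.exp.sub ((h2.comp hp).mul (ht.mul (contDiff_Ef.comp h1')))

theorem leibniz {h h' : ℝ → ℝ → ℝ} (hc : Continuous (fun p : ℝ × ℝ => h p.1 p.2))
    (hc' : Continuous (fun p : ℝ × ℝ => h' p.1 p.2))
    (hd : ∀ s τ, HasDerivAt (fun τ => h s τ) (h' s τ) τ) (a b τ : ℝ) :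
    HasDerivAt (fun τ => ∫ t in a..b, h t τ) (∫ t in a..b, h' t τ) τ := by
  obtain ⟨C, hC⟩ := (isCompact_uIcc (a := a) (b := b)).prod
    (isCompact_Icc (a := τ - 1) (b := τ + 1)) |>.exists_bound_of_continuousOn hc'.continuousOn
  have hsl : ∀ x, Continuous (fun t => h t x) := fun x =>
    hc.comp (continuous_id.prodMk continuous_const)
  have hsl' : ∀ x, Continuous (fun t => h' t x) := fun x =>
    hc'.comp (continuous_id.prodMk continuous_const)
  refine (intervalIntegral.hasDerivAt_integral_of_dominated_loc_of_deriv_le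
    (F := fun τ t => h t τ) (F' := fun τ t => h' t τ) (bound := fun _ => C)
    (s := Set.Icc (τ - 1) (τ + 1)) (Icc_mem_nhds (by linarith) (by linarith))
    (Eventually.of_forall fun x => (hsl x).aestronglyMeasurable)
    ((hsl τ).intervalIntegrable _ _) (hsl' τ).aestronglyMeasurable ?_
    intervalIntegrable_const ?_).2
  · exact Eventually.of_forall fun t ht x hx => hC (t, x) ⟨Set.uIoc_subset_uIcc ht, hx⟩
  · exact Eventually.of_forall fun t ht x hx => hd t x

theorem slice_mono {Q K : ℝ × ℝ × ℝ → ℝ}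
    (hK : ∀ p, HasDerivAt (fun s => Q (s, p.2)) (K p) p.1) {I : Set ℝ}
    (hpos : ∀ p, p.2.2 ∈ I → 0 < K p) (y : ℝ × ℝ) (hy : y.2 ∈ I) :
    StrictMono (fun s => Q (s, y)) :=
  strictMono_of_hasDerivAt_pos (fun s => hK (s, y)) (fun s => hpos (s, y) hy)

theorem smooth_inverse {Q K : ℝ × ℝ × ℝ → ℝ} (hQ : ContDiff ℝ (⊤ : ℕ∞) Q)
    (hK : ∀ p, HasDerivAt (fun s => Q (s, p.2)) (K p) p.1) {I : Set ℝ} (hI : IsOpen I)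
    (hpos : ∀ p, p.2.2 ∈ I → 0 < K p) {S : ℝ × ℝ × ℝ → ℝ}
    (hS : ∀ p, p.2.2 ∈ I → Q (S p, p.2) = p.1) (p : ℝ × ℝ × ℝ) (hp : p.2.2 ∈ I) :
    ContDiffAt ℝ (⊤ : ℕ∞) S p := by
  set x0 : ℝ × ℝ × ℝ := (S p, p.2) with hx0
  set L : ℝ × ℝ × ℝ →L[ℝ] ℝ := fderiv ℝ Q x0 with hL
  set k : ℝ := K x0 with hk
  have hk0 : k ≠ 0 := (hpos x0 hp).ne'
  have hQd : HasFDerivAt Q L x0 := (hQ.differentiable (by simp) x0).hasFDerivAt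
  have hL1 : L (1, 0) = k := by
    have h2 : HasDerivAt (fun s : ℝ => (s, x0.2)) (1, 0) x0.1 :=
      (hasDerivAt_id _).prodMk (hasDerivAt_const _ _)
    exact (hQd.comp_hasDerivAt x0.1 h2).unique (hK x0)
  have hLd : ∀ v : ℝ × ℝ × ℝ, L v = k * v.1 + L (0, v.2) := by
    intro v
    have : v = v.1 • ((1, 0) : ℝ × ℝ × ℝ) + (0, v.2) := by ext <;> simp
    conv_lhs => rw [this]
    rw [map_add, map_smul, hL1, smul_eq_mul, mul_comm]
  let A : ℝ × ℝ × ℝ →L[ℝ] ℝ × ℝ × ℝ := L.prod (ContinuousLinearMap.snd ℝ ℝ (ℝ × ℝ))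
  let B : ℝ × ℝ × ℝ →L[ℝ] ℝ × ℝ × ℝ :=
    (k⁻¹ • (ContinuousLinearMap.fst ℝ ℝ (ℝ × ℝ) -
      L.comp ((0 : ℝ × ℝ × ℝ →L[ℝ] ℝ).prod (ContinuousLinearMap.snd ℝ ℝ (ℝ × ℝ))))).prod
      (ContinuousLinearMap.snd ℝ ℝ (ℝ × ℝ))
  let e : (ℝ × ℝ × ℝ) ≃L[ℝ] (ℝ × ℝ × ℝ) := ContinuousLinearEquiv.equivOfInverse A B
    (by
      intro v
      refine Prod.ext ?_ rfl
      change k⁻¹ * (L v - L (0, v.2)) = v.1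
      rw [hLd v]; field_simp; ring)
    (by
      intro v
      refine Prod.ext ?_ rfl
      change L (k⁻¹ * (v.1 - L (0, v.2)), v.2) = v.1
      rw [hLd]; simp only; field_simp; ring)
  have hΦ : ContDiffAt ℝ (⊤ : ℕ∞) (fun x : ℝ × ℝ × ℝ => (Q x, x.2)) x0 :=
    (hQ.prodMk contDiff_snd).contDiffAt
  have hΦ' : HasFDerivAt (fun x : ℝ × ℝ × ℝ => (Q x, x.2)) (e : ℝ × ℝ × ℝ →L[ℝ] ℝ × ℝ × ℝ) x0 :=
    hQd.prodMk hasFDerivAt_snd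
  have hn : ((⊤ : ℕ∞) : WithTop ℕ∞) ≠ 0 := by simp
  have hloc := hΦ.to_localInverse hΦ' hn
  have hval : (Q x0, x0.2) = p := Prod.ext (hS p hp) rfl
  have hright : ∀ᶠ y in 𝓝 p, (fun x : ℝ × ℝ × ℝ => (Q x, x.2)) (hΦ.localInverse hΦ' hn y) = y := by
    have := (hΦ.hasStrictFDerivAt' hΦ' hn).eventually_right_inverse
    rw [hval] at this
    exact this
  rw [hval] at hloc
  have hI' : ∀ᶠ y : ℝ × ℝ × ℝ in 𝓝 p, y.2.2 ∈ I :=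
    (continuous_snd.snd.tendsto p).eventually (hI.mem_nhds hp)
  refine (contDiffAt_fst.comp p hloc).congr_of_eventuallyEq ?_
  filter_upwards [hright, hI'] with y hy hyI
  refine (slice_mono hK hpos y.2 hyI).injective ?_
  simp only [Function.comp]
  rw [hS y hyI]
  have h1 := congrArg Prod.fst hy
  have h2 := congrArg Prod.snd hy
  simp only at h1 h2
  rw [← h2]
  exact h1.symm

theorem slice_surj {Q : ℝ → ℝ} {K : ℝ → ℝ} {M S0 : ℝ}
    (hK : ∀ s, HasDerivAt Q (K s) s) (hM : ∀ s, M ≤ s → Q s = s)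
    (hS0 : ∀ s ≤ S0, 1 / 2 ≤ K s) (y : ℝ) : ∃ s, Q s = y := by
  have hc : Continuous Q := continuous_iff_continuousAt.2 fun s => (hK s).continuousAt
  have hd : ∀ s, HasDerivAt (fun s => Q s - 1 / 2 * s) (K s - 1 / 2) s := fun s =>
    ((hK s).sub ((hasDerivAt_id s).const_mul (1 / 2))).congr_deriv (by simp)
  have hmono : MonotoneOn (fun s => Q s - 1 / 2 * s) (Set.Iic S0) := by
    refine monotoneOn_of_deriv_nonneg (convex_Iic S0)
      (fun s _ => (hd s).continuousAt.continuousWithinAt)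
      (fun s _ => (hd s).differentiableAt.differentiableWithinAt) ?_
    intro s hs
    rw [interior_Iic] at hs
    rw [(hd s).deriv]
    linarith [hS0 s (le_of_lt hs)]
  obtain ⟨s1, h1, h2⟩ : ∃ s1, s1 ≤ S0 ∧ Q s1 ≤ y := by
    refine ⟨min S0 (2 * (y - (Q S0 - 1 / 2 * S0))), min_le_left _ _, ?_⟩
    have h := hmono (Set.mem_Iic.2 (min_le_left S0 (2 * (y - (Q S0 - 1 / 2 * S0)))))
      (Set.mem_Iic.2 le_rfl) (min_le_left _ _)
    have h' := min_le_right S0 (2 * (y - (Q S0 - 1 / 2 * S0)))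
    simp only at h
    linarith
  have h3 : y ≤ Q (max (max M y) s1) := by
    rw [hM _ ((le_max_left M y).trans (le_max_left _ _))]
    exact (le_max_right M y).trans (le_max_left _ _)
  obtain ⟨s, -, hs⟩ := intermediate_value_Icc (le_max_right (max M y) s1) hc.continuousOn ⟨h2, h3⟩
  exact ⟨s, hs⟩

theorem bdd_of_decay {M : ℝ} {F : ℝ → ℝ → ℝ} (hc : Continuous (fun p : ℝ × ℝ => F p.1 p.2))
    (per : ∀ σ θ, F σ (θ + 2 * π) = F σ θ) (supp : ∀ σ θ, M < σ → F σ θ = 0)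
    (decay : ∀ ε > 0, ∃ S, ∀ σ ≤ S, ∀ θ, |F σ θ| ≤ ε) : ∃ C, 0 ≤ C ∧ ∀ σ θ, |F σ θ| ≤ C := by
  obtain ⟨S, hS⟩ := decay 1 one_pos
  obtain ⟨C, h0, hC⟩ := bounded_of_periodic (g := fun p => F p.2 p.1)
    (hc.comp (continuous_snd.prodMk continuous_fst)) (fun θ s => per s θ) S M
  refine ⟨max C 1, h0.trans (le_max_left _ _), fun σ θ => ?_⟩
  rcases le_total σ S with h | h
  · exact (hS σ h θ).trans (le_max_right _ _)
  · rcases le_or_gt σ M with h' | h'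
    · exact (hC θ σ h h').trans (le_max_left _ _)
    · rw [supp σ θ h']; simp [h0]

theorem mul_decay {a : ℝ → ℝ} {A : ℝ} (hA0 : 0 ≤ A) (hA : ∀ θ, |a θ| ≤ A) {F : ℝ → ℝ → ℝ}
    (decay : ∀ ε > 0, ∃ S, ∀ σ ≤ S, ∀ θ, |F σ θ| ≤ ε) :
    ∀ ε > 0, ∃ S, ∀ σ ≤ S, ∀ θ, |a θ * F σ θ| ≤ ε := by
  intro ε hε
  obtain ⟨S, hS⟩ := decay (ε / (A + 1)) (by positivity)
  refine ⟨S, fun σ h θ => ?_⟩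
  rw [abs_mul]
  calc |a θ| * |F σ θ| ≤ (A + 1) * (ε / (A + 1)) :=
        mul_le_mul ((hA θ).trans (by linarith)) (hS σ h θ) (abs_nonneg _) (by linarith)
    _ = ε := by field_simp

theorem core {M : ℝ} {F : ℝ → ℝ → ℝ} (hF : RadField M F) {a b : ℝ → ℝ}
    (ha : ContDiff ℝ (⊤ : ℕ∞) a) (hb : ContDiff ℝ (⊤ : ℕ∞) b)
    (hap : ∀ θ, a (θ + 2 * π) = a θ) (hbp : ∀ θ, b (θ + 2 * π) = b θ) {T : ℝ} (hT : 0 < T)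
    (hpos : ∀ s θ τ, 0 ≤ τ → τ < T →
      0 < Kf (fun s θ => a θ * dS F s θ) (fun s θ => b θ * dS (dS F) s θ) s θ τ) :
    ∃ V : ℝ → ℝ → ℝ → ℝ,
      ContDiffOn ℝ (⊤ : ℕ∞) (fun p : ℝ × ℝ × ℝ => V p.1 p.2.1 p.2.2)
        {p : ℝ × ℝ × ℝ | 0 ≤ p.2.2 ∧ p.2.2 < T} ∧
      (∀ q θ τ : ℝ, V q (θ + 2 * π) τ = V q θ τ) ∧
      (∀ q θ τ : ℝ, M < q → V q θ τ = 0) ∧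
      (∀ q θ : ℝ, V q θ 0 = F q θ) ∧
      (∀ q θ τ : ℝ, 0 ≤ τ → τ < T →
        deriv (fun τ' => deriv (fun q' => V q' θ τ') q) τ =
          (a θ * V q θ τ + b θ * deriv (fun q' => V q' θ τ) q) *
            deriv (fun q' => deriv (fun q'' => V q'' θ τ) q') q) := by
  set f1 : ℝ → ℝ → ℝ := fun s θ => a θ * dS F s θ with hf1
  set f2 : ℝ → ℝ → ℝ := fun s θ => b θ * dS (dS F) s θ with hf2
  -- smoothness
  have s1 := contDiff_dS hF.smooth
  have s2 := contDiff_dS s1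
  have z0 := supp_closed hF.smooth hF.supp
  have z1 := supp_closed s1 (supp_dS hF.supp)
  have z2 := supp_closed s2 (supp_dS (supp_dS hF.supp))
  have p1 := per_dS hF.per
  have p2 := per_dS p1
  have sf1 : ContDiff ℝ (⊤ : ℕ∞) (fun p : ℝ × ℝ => f1 p.1 p.2) := (ha.comp contDiff_snd).mul s1
  have sf2 : ContDiff ℝ (⊤ : ℕ∞) (fun p : ℝ × ℝ => f2 p.1 p.2) := (hb.comp contDiff_snd).mul s2
  have sK := contDiff_Kf sf1 sf2
  have pf1 : ∀ s θ, f1 s (θ + 2 * π) = f1 s θ := fun s θ => by simp only [hf1, hap, p1]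
  have pf2 : ∀ s θ, f2 s (θ + 2 * π) = f2 s θ := fun s θ => by simp only [hf2, hbp, p2]
  have pK : ∀ s θ τ, Kf f1 f2 s (θ + 2 * π) τ = Kf f1 f2 s θ τ := fun s θ τ => by
    simp only [Kf, pf1, pf2]
  -- decay and bounds
  obtain ⟨A, hA0, hA⟩ := bounded_of_periodic (g := fun p => a p.1) (ha.continuous.comp continuous_fst)
    (fun θ s => hap θ) 0 0
  obtain ⟨B, hB0, hB⟩ := bounded_of_periodic (g := fun p => b p.1) (hb.continuous.comp continuous_fst)
    (fun θ s => hbp θ) 0 0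
  have d1 : ∀ ε > 0, ∃ S, ∀ σ ≤ S, ∀ θ, |f1 σ θ| ≤ ε :=
    mul_decay hA0 (fun θ => hA θ 0 le_rfl le_rfl) hF.decay1
  have d2 : ∀ ε > 0, ∃ S, ∀ σ ≤ S, ∀ θ, |f2 σ θ| ≤ ε :=
    mul_decay hB0 (fun θ => hB θ 0 le_rfl le_rfl) hF.decay2
  obtain ⟨C1, hC10, hC1⟩ := bdd_of_decay (M := M) sf1.continuous pf1
    (fun σ θ h => by simp only [hf1, z1 σ θ h.le, mul_zero]) d1
  obtain ⟨C2, hC20, hC2⟩ := bdd_of_decay (M := M) sf2.continuous pf2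
    (fun σ θ h => by simp only [hf2, z2 σ θ h.le, mul_zero]) d2
  obtain ⟨δ, hδ, hδ1⟩ : ∃ δ : ℝ, 0 < δ ∧ δ * (C1 + C2 + 1) = 1 / 8 :=
    ⟨1 / 8 / (C1 + C2 + 1), by positivity, by field_simp⟩
  set I : Set ℝ := Set.Ioo (-δ) T with hIdef
  have hIo : IsOpen I := isOpen_Ioo
  have hI0 : (0:ℝ) ∈ I := ⟨by linarith, hT⟩
  have hIT : ∀ τ, 0 ≤ τ → τ < T → τ ∈ I := fun τ h1 h2 => ⟨by linarith, h2⟩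
  have hposI : ∀ s θ τ, τ ∈ I → 0 < Kf f1 f2 s θ τ := by
    intro s θ τ hτ
    rcases le_or_gt 0 τ with h | h
    · exact hpos s θ τ h hτ.2
    · have hab : |τ| ≤ δ := by rw [abs_of_neg h]; linarith [hτ.1]
      have : 1 / 2 ≤ Kf f1 f2 s θ τ := by
        apply Kf_ge
        · rw [abs_mul]
          have := mul_le_mul hab (hC1 s θ) (abs_nonneg _) hδ.le
          nlinarith
        · rw [abs_mul]
          have := mul_le_mul hab (hC2 s θ) (abs_nonneg _) hδ.le
          nlinarith
      linarith
  -- the characteristic map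
  set K : ℝ × ℝ × ℝ → ℝ := fun p => Kf f1 f2 p.1 p.2.1 p.2.2 with hKdef
  set Q : ℝ × ℝ × ℝ → ℝ := fun p => M + ∫ t in M..p.1, K (t, p.2) with hQdef
  set N : ℝ × ℝ × ℝ → ℝ := fun p => ∫ t in M..p.1, dS F t p.2.1 * K (t, p.2) with hNdef
  have sQ : ContDiff ℝ (⊤ : ℕ∞) Q := contDiff_const.add (contDiff_param_integral' M K sK)
  have hproj : ContDiff ℝ (⊤ : ℕ∞) (fun p : ℝ × ℝ × ℝ => (p.1, p.2.1)) := by fun_prop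
  have sW : ContDiff ℝ (⊤ : ℕ∞) (fun p : ℝ × ℝ × ℝ => dS F p.1 p.2.1 * K p) :=
    (s1.comp hproj).mul sK
  have sN : ContDiff ℝ (⊤ : ℕ∞) N := contDiff_param_integral' M _ sW
  have cK : ∀ y : ℝ × ℝ, Continuous (fun t => K (t, y)) := fun y =>
    sK.continuous.comp (continuous_id.prodMk continuous_const)
  have cW : ∀ y : ℝ × ℝ, Continuous (fun t => dS F t y.1 * K (t, y)) := fun y =>
    sW.continuous.comp (continuous_id.prodMk continuous_const)
  have hQs : ∀ p, HasDerivAt (fun s => Q (s, p.2)) (K p) p.1 := fun p =>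
    ((cK p.2).integral_hasStrictDerivAt M p.1).hasDerivAt.const_add M
  have hNs : ∀ p, HasDerivAt (fun s => N (s, p.2)) (dS F p.1 p.2.1 * K p) p.1 := fun p =>
    ((cW p.2).integral_hasStrictDerivAt M p.1).hasDerivAt
  have hQt : ∀ s θ τ, HasDerivAt (fun τ => Q (s, θ, τ)) (-(a θ * N (s, θ, τ) + b θ * dS F s θ)) τ := by
    intro s θ τ
    have hcK : Continuous (fun p : ℝ × ℝ => K (p.1, θ, p.2)) :=
      sK.continuous.comp (continuous_fst.prodMk (continuous_const.prodMk continuous_snd))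
    have hcf1 : Continuous (fun p : ℝ × ℝ => f1 p.1 θ) :=
      sf1.continuous.comp (continuous_fst.prodMk continuous_const)
    have hcf2 : Continuous (fun p : ℝ × ℝ => f2 p.1 θ) :=
      sf2.continuous.comp (continuous_fst.prodMk continuous_const)
    have h := (leibniz (h := fun s τ => K (s, θ, τ))
      (h' := fun s τ => -(f1 s θ * K (s, θ, τ) + f2 s θ)) hcK
      ((hcf1.mul hcK).add hcf2).neg (fun s τ => hasDerivAt_Kf f1 f2 s θ τ) M s τ).const_add M
    refine h.congr_deriv ?_
    have i1 : IntervalIntegrable (fun t => a θ * (dS F t θ * K (t, θ, τ))) volume M s :=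
      (continuous_const.mul (cW (θ, τ))).intervalIntegrable _ _
    have c2 : Continuous (fun t => dS (dS F) t θ) :=
      s2.continuous.comp (continuous_id.prodMk continuous_const)
    have i2 : IntervalIntegrable (fun t => b θ * dS (dS F) t θ) volume M s :=
      (continuous_const.mul c2).intervalIntegrable _ _
    have e1 : ∀ t, f1 t θ * K (t, θ, τ) + f2 t θ =
        a θ * (dS F t θ * K (t, θ, τ)) + b θ * dS (dS F) t θ := fun t => by
      simp only [hf1, hf2]; ring
    rw [intervalIntegral.integral_neg]
    simp only [e1]
    rw [intervalIntegral.integral_add i1 i2, intervalIntegral.integral_const_mul,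
      intervalIntegral.integral_const_mul,
      intervalIntegral.integral_eq_sub_of_hasDerivAt (fun t _ => hasDerivAt_dS s1 t θ)
        (c2.intervalIntegrable _ _), z1 M θ le_rfl, sub_zero]
  have hKM : ∀ s y, M ≤ s → K (s, y) = 1 := by
    intro s y hs
    simp [hKdef, Kf, hf1, hf2, z1 s y.1 hs, z2 s y.1 hs]
  have hQM : ∀ s y, M ≤ s → Q (s, y) = s := by
    intro s y hs
    have : ∫ t in M..s, K (t, y) = ∫ t in M..s, (1:ℝ) := by
      apply intervalIntegral.integral_congr
      intro t ht
      rw [Set.uIcc_of_le hs] at ht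
      exact hKM t y ht.1
    simp only [hQdef, this]; simp
  have hNM : ∀ s y, M ≤ s → N (s, y) = 0 := by
    intro s y hs
    have : ∫ t in M..s, dS F t y.1 * K (t, y) = ∫ t in M..s, (0:ℝ) := by
      apply intervalIntegral.integral_congr
      intro t ht
      rw [Set.uIcc_of_le hs] at ht
      simp [z1 t y.1 ht.1]
    simp only [hNdef, this]; simp
  have hQ0 : ∀ s θ, Q (s, θ, 0) = s := by
    intro s θ; simp [hQdef, hKdef, Kf_zero]
  have hN0 : ∀ s θ, N (s, θ, 0) = F s θ := by
    intro s θ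
    have c1 : Continuous (fun t => dS F t θ) :=
      s1.continuous.comp (continuous_id.prodMk continuous_const)
    simp only [hNdef, hKdef, Kf_zero, mul_one]
    rw [intervalIntegral.integral_eq_sub_of_hasDerivAt (fun t _ => hasDerivAt_dS hF.smooth t θ)
        (c1.intervalIntegrable _ _), z0 M θ le_rfl, sub_zero]
  have hQp : ∀ s θ τ, Q (s, θ + 2 * π, τ) = Q (s, θ, τ) := by
    intro s θ τ; simp only [hQdef, hKdef, pK]
  have hNp : ∀ s θ τ, N (s, θ + 2 * π, τ) = N (s, θ, τ) := by
    intro s θ τ; simp only [hNdef, hKdef, pK, p1]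
  have hKI : ∀ p : ℝ × ℝ × ℝ, p.2.2 ∈ I → 0 < K p := fun p hp => hposI _ _ _ hp
  have hsurj : ∀ p : ℝ × ℝ × ℝ, ∃ s, Q (s, p.2) = p.1 := by
    intro p
    obtain ⟨S1, hS1⟩ := d1 (1 / 8 / (|p.2.2| + 1)) (by positivity)
    obtain ⟨S2, hS2⟩ := d2 (1 / 8 / (|p.2.2| + 1)) (by positivity)
    have hbd : ∀ x : ℝ, |x| ≤ 1 / 8 / (|p.2.2| + 1) → |p.2.2 * x| ≤ 1 / 8 := by
      intro x hx
      rw [abs_mul]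
      rw [le_div_iff₀ (by positivity)] at hx
      nlinarith [abs_nonneg x]
    refine slice_surj (Q := fun s => Q (s, p.2)) (K := fun s => K (s, p.2)) (M := M)
      (S0 := min S1 S2) (fun s => hQs (s, p.2)) (fun s hs => hQM s p.2 hs) ?_ p.1
    intro s hs
    exact Kf_ge (hbd _ (hS1 s (hs.trans (min_le_left _ _)) _))
      (hbd _ (hS2 s (hs.trans (min_le_right _ _)) _))
  choose S hS using hsurj
  have hinj : ∀ y : ℝ × ℝ, y.2 ∈ I → Function.Injective (fun s => Q (s, y)) := fun y hy =>
    (slice_mono hQs hKI y hy).injective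
  have sS : ∀ p : ℝ × ℝ × ℝ, p.2.2 ∈ I → ContDiffAt ℝ (⊤ : ℕ∞) S p := fun p hp =>
    smooth_inverse sQ hQs hIo hKI (fun p _ => hS p) p hp
  -- derivatives of S
  have hSq : ∀ q θ τ, τ ∈ I → HasDerivAt (fun q' => S (q', θ, τ)) (K (S (q, θ, τ), θ, τ))⁻¹ q := by
    intro q θ τ hτ
    have hk := (hKI (S (q, θ, τ), θ, τ) hτ).ne'
    have hd : DifferentiableAt ℝ (fun q' => S (q', θ, τ)) q :=
      ((sS (q, θ, τ) hτ).differentiableAt (by simp)).comp q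
        (differentiableAt_id.prodMk (differentiableAt_const _))
    have h1 := (hQs (S (q, θ, τ), θ, τ)).comp q hd.hasDerivAt
    have h2 : (fun s => Q (s, θ, τ)) ∘ (fun q' => S (q', θ, τ)) = fun q' => q' := by
      funext q'; exact hS (q', θ, τ)
    simp only at h1
    rw [h2] at h1
    have h3 := h1.unique (hasDerivAt_id q)
    refine hd.hasDerivAt.congr_deriv ?_
    field_simp
    linarith
  have hSt : ∀ q θ τ, τ ∈ I → HasDerivAt (fun τ' => S (q, θ, τ'))
      ((a θ * N (S (q, θ, τ), θ, τ) + b θ * dS F (S (q, θ, τ)) θ) / K (S (q, θ, τ), θ, τ)) τ := by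
    intro q θ τ hτ
    have hk := (hKI (S (q, θ, τ), θ, τ) hτ).ne'
    have hd : DifferentiableAt ℝ (fun τ' => S (q, θ, τ')) τ :=
      ((sS (q, θ, τ) hτ).differentiableAt (by simp)).comp τ
        ((differentiableAt_const _).prodMk ((differentiableAt_const _).prodMk differentiableAt_id))
    set x0 : ℝ × ℝ × ℝ := (S (q, θ, τ), θ, τ) with hx0
    have hQd : HasFDerivAt Q (fderiv ℝ Q x0) x0 := (sQ.differentiable (by simp) x0).hasFDerivAt
    have e1 : fderiv ℝ Q x0 (1, 0, 0) = K x0 := by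
      have h2 : HasDerivAt (fun s : ℝ => (s, θ, τ)) ((1, 0, 0) : ℝ × ℝ × ℝ) x0.1 :=
        (hasDerivAt_id _).prodMk (hasDerivAt_const _ _)
      exact (HasFDerivAt.comp_hasDerivAt (f := fun s : ℝ => (s, θ, τ)) x0.1 hQd h2).unique
        (hQs x0)
    have e2 : fderiv ℝ Q x0 (0, 0, 1) = -(a θ * N x0 + b θ * dS F x0.1 θ) := by
      have h2 : HasDerivAt (fun t : ℝ => (x0.1, θ, t)) ((0, 0, 1) : ℝ × ℝ × ℝ) τ :=
        (hasDerivAt_const _ _).prodMk ((hasDerivAt_const _ _).prodMk (hasDerivAt_id _))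
      exact (HasFDerivAt.comp_hasDerivAt (f := fun t : ℝ => (x0.1, θ, t)) τ hQd h2).unique
        (hQt x0.1 θ τ)
    set m := deriv (fun τ' => S (q, θ, τ')) τ with hm
    have h3 : HasDerivAt (fun t : ℝ => (S (q, θ, t), θ, t)) ((m, 0, 1) : ℝ × ℝ × ℝ) τ :=
      hd.hasDerivAt.prodMk ((hasDerivAt_const _ _).prodMk (hasDerivAt_id _))
    have h4 := HasFDerivAt.comp_hasDerivAt (f := fun t : ℝ => (S (q, θ, t), θ, t)) τ hQd h3
    have h5 : Q ∘ (fun t : ℝ => (S (q, θ, t), θ, t)) = fun _ => q := by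
      funext t; exact hS (q, θ, t)
    rw [h5] at h4
    have h6 := h4.unique (hasDerivAt_const τ q)
    have h7 : ((m, 0, 1) : ℝ × ℝ × ℝ) = m • ((1, 0, 0) : ℝ × ℝ × ℝ) + (0, 0, 1) := by
      ext <;> simp
    rw [h7, map_add, map_smul, e1, e2, smul_eq_mul] at h6
    refine hd.hasDerivAt.congr_deriv ?_
    rw [eq_div_iff hk]
    linarith
  classical
  let V : ℝ → ℝ → ℝ → ℝ := fun q θ τ => if τ ∈ I then N (S (q, θ, τ), θ, τ) else F q θ
  have hV : ∀ q θ τ, τ ∈ I → V q θ τ = N (S (q, θ, τ), θ, τ) := fun q θ τ h => if_pos h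
  have hVq : ∀ q θ τ, τ ∈ I → HasDerivAt (fun q' => V q' θ τ) (dS F (S (q, θ, τ)) θ) q := by
    intro q θ τ hτ
    have hk := (hKI (S (q, θ, τ), θ, τ) hτ).ne'
    have h1 := (hNs (S (q, θ, τ), θ, τ)).comp q (hSq q θ τ hτ)
    have h2 : (fun q' => V q' θ τ) = (fun s => N (s, θ, τ)) ∘ (fun q' => S (q', θ, τ)) := by
      funext q'; exact hV q' θ τ hτ
    rw [h2]
    refine h1.congr_deriv ?_
    simp only
    field_simp
  refine ⟨V, ?_, ?_, ?_, ?_, ?_⟩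
  · intro p hp
    have hpI := hIT _ hp.1 hp.2
    have h1 : ContDiffAt ℝ (⊤ : ℕ∞) (fun p : ℝ × ℝ × ℝ => N (S p, p.2)) p :=
      sN.contDiffAt.comp p ((sS p hpI).prodMk contDiffAt_snd)
    refine (h1.congr_of_eventuallyEq ?_).contDiffWithinAt
    have hI' : ∀ᶠ y : ℝ × ℝ × ℝ in 𝓝 p, y.2.2 ∈ I :=
      (continuous_snd.snd.tendsto p).eventually (hIo.mem_nhds hpI)
    filter_upwards [hI'] with y hy
    exact hV _ _ _ hy
  · intro q θ τ
    by_cases hτ : τ ∈ I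
    · rw [hV _ _ _ hτ, hV _ _ _ hτ, hNp]
      have : S (q, θ + 2 * π, τ) = S (q, θ, τ) := by
        apply hinj (θ, τ) hτ
        simp only
        rw [hS (q, θ, τ), ← hQp]
        exact hS (q, θ + 2 * π, τ)
      rw [this]
    · simp only [V, if_neg hτ, hF.per]
  · intro q θ τ hq
    by_cases hτ : τ ∈ I
    · rw [hV _ _ _ hτ]
      have : S (q, θ, τ) = q := by
        apply hinj (θ, τ) hτ
        simp only
        rw [hS (q, θ, τ), hQM _ _ hq.le]
      rw [this, hNM _ _ hq.le]
    · simp only [V, if_neg hτ, hF.supp q θ hq]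
  · intro q θ
    rw [hV _ _ _ hI0]
    have : S (q, θ, 0) = q := by
      have := hS (q, θ, 0)
      rwa [hQ0] at this
    rw [this, hN0]
  · intro q θ τ h0 hT'
    have hτ := hIT τ h0 hT'
    have hk := (hKI (S (q, θ, τ), θ, τ) hτ).ne'
    have e1 : (fun q' => deriv (fun q'' => V q'' θ τ) q') = fun q' => dS F (S (q', θ, τ)) θ := by
      funext q'; exact (hVq q' θ τ hτ).deriv
    have e2 : (fun τ' => deriv (fun q' => V q' θ τ') q) =ᶠ[𝓝 τ] fun τ' => dS F (S (q, θ, τ')) θ := by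
      filter_upwards [hIo.mem_nhds hτ] with τ' h'
      exact (hVq q θ τ' h').deriv
    have g1 := ((hasDerivAt_dS s1 (S (q, θ, τ)) θ).comp q (hSq q θ τ hτ)).deriv
    have g2 := ((hasDerivAt_dS s1 (S (q, θ, τ)) θ).comp τ (hSt q θ τ hτ)).deriv
    simp only [Function.comp_def] at g1 g2
    rw [e1, e2.deriv_eq, (hVq q θ τ hτ).deriv, g1, g2, hV _ _ _ hτ]
    field_simp

noncomputable def aC (d : Fin 3 → Fin 3 → ℝ) (θ : ℝ) : ℝ :=
  ∑ i : Fin 3, ∑ j : Fin 3, d i j * omegaHat θ i * omegaHat θ j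

noncomputable def bC (e : Fin 3 → Fin 3 → Fin 3 → ℝ) (θ : ℝ) : ℝ :=
  ∑ i : Fin 3, ∑ j : Fin 3, ∑ k : Fin 3, e i j k * omegaHat θ i * omegaHat θ j * omegaHat θ k

theorem omega_per (θ : ℝ) : omegaHat (θ + 2 * π) = omegaHat θ := by
  simp [omegaHat]

theorem omega_smooth (i : Fin 3) : ContDiff ℝ (⊤ : ℕ∞) (fun θ => omegaHat θ i) := by
  fin_cases i
  · simpa [omegaHat] using contDiff_const
  · simpa [omegaHat] using Real.contDiff_cos
  · simpa [omegaHat] using Real.contDiff_sin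

theorem omega_analytic (i : Fin 3) (x : ℝ) : AnalyticAt ℝ (fun θ => omegaHat θ i) x := by
  fin_cases i
  · simpa [omegaHat] using analyticAt_const
  · simpa [omegaHat] using Real.analyticAt_cos
  · simpa [omegaHat] using Real.analyticAt_sin

theorem aC_smooth (d : Fin 3 → Fin 3 → ℝ) : ContDiff ℝ (⊤ : ℕ∞) (aC d) := by
  unfold aC
  refine ContDiff.sum fun i _ => ContDiff.sum fun j _ => ?_
  exact (contDiff_const.mul (omega_smooth i)).mul (omega_smooth j)

theorem bC_smooth (e : Fin 3 → Fin 3 → Fin 3 → ℝ) : ContDiff ℝ (⊤ : ℕ∞) (bC e) := by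
  unfold bC
  refine ContDiff.sum fun i _ => ContDiff.sum fun j _ => ContDiff.sum fun k _ => ?_
  exact ((contDiff_const.mul (omega_smooth i)).mul (omega_smooth j)).mul (omega_smooth k)

theorem aC_analytic (d : Fin 3 → Fin 3 → ℝ) : AnalyticOnNhd ℝ (aC d) Set.univ := by
  intro x _
  unfold aC
  refine Finset.analyticAt_fun_sum _ fun i _ => Finset.analyticAt_fun_sum _ fun j _ => ?_
  exact (analyticAt_const.mul (omega_analytic i x)).mul (omega_analytic j x)

theorem aC_not_locally_zero (d : Fin 3 → Fin 3 → ℝ)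
    (hdsymm : ∀ i j, d i j = d j i) (hd00 : d 0 0 = 0)
    (hdne : ∃ i j : Fin 3, (i, j) ≠ ((0 : Fin 3), (0 : Fin 3)) ∧ d i j ≠ 0) (θ : ℝ) :
    ¬ (∀ᶠ x in 𝓝 θ, aC d x = 0) := by
  intro h
  have hz := (aC_analytic d).eqOn_zero_of_preconnected_of_eventuallyEq_zero
    isPreconnected_univ (Set.mem_univ θ) h
  have h0 := hz (Set.mem_univ 0)
  have h1 := hz (Set.mem_univ π)
  have h2 := hz (Set.mem_univ (π / 2))
  have h3 := hz (Set.mem_univ (-(π / 2)))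
  have h4 := hz (Set.mem_univ (π / 4))
  have s01 := hdsymm 0 1
  have s02 := hdsymm 0 2
  have s12 := hdsymm 1 2
  simp [aC, Fin.sum_univ_three, omegaHat] at h0 h1 h2 h3 h4
  have e01 : d 0 1 = 0 := by linarith
  have e11 : d 1 1 = 0 := by linarith
  have e02 : d 0 2 = 0 := by linarith
  have e22 : d 2 2 = 0 := by linarith
  have e12 : d 1 2 = 0 := by
    rw [← s01, ← s02, ← s12, e01, e11, e02, e22, hd00] at h4
    have : Real.sqrt 2 * Real.sqrt 2 = 2 := by norm_num
    nlinarith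
  obtain ⟨i, j, -, hij⟩ := hdne
  apply hij
  fin_cases i <;> fin_cases j <;> simp <;> linarith

theorem slice_cont {D : ℝ → ℝ → ℝ} (h : Continuous (fun p : ℝ × ℝ => D p.1 p.2)) (s : ℝ) :
    Continuous (fun x => D s x) :=
  h.comp (continuous_const.prodMk continuous_id)

theorem Kf_pos {M : ℝ} {φ0 φ1 : ℝ × ℝ → ℝ} (hF : RadField M (F0 φ0 φ1))
    (d : Fin 3 → Fin 3 → ℝ) (e : Fin 3 → Fin 3 → Fin 3 → ℝ)
    (ha : ∀ θ, ¬ (∀ᶠ x in 𝓝 θ, aC d x = 0)) (s θ τ : ℝ) (h0 : 0 ≤ τ)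
    (hτ : τ < tau0 M d e φ0 φ1) : 0 < Kf (F1 d φ0 φ1) (F2 e φ0 φ1) s θ τ := by
  have s1 := contDiff_dS hF.smooth
  have s2 := contDiff_dS s1
  have p1 := per_dS hF.per
  have p2 := per_dS p1
  have sF1 : ContDiff ℝ (⊤ : ℕ∞) (fun p : ℝ × ℝ => F1 d φ0 φ1 p.1 p.2) :=
    ((aC_smooth d).comp contDiff_snd).mul s1
  have sF2 : ContDiff ℝ (⊤ : ℕ∞) (fun p : ℝ × ℝ => F2 e φ0 φ1 p.1 p.2) :=
    ((bC_smooth e).comp contDiff_snd).mul s2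
  have eF1 : ∀ σ θ, F1 d φ0 φ1 σ θ = aC d θ * dS (F0 φ0 φ1) σ θ := fun _ _ => rfl
  have eF2 : ∀ σ θ, F2 e φ0 φ1 σ θ = bC e θ * dS (dS (F0 φ0 φ1)) σ θ := fun _ _ => rfl
  have z1 := supp_closed s1 (supp_dS hF.supp)
  have pF1 : ∀ σ, Function.Periodic (F1 d φ0 φ1 σ) (2 * π) := fun σ θ => by
    rw [eF1, eF1, p1]; simp only [aC, omega_per]
  have pF2 : ∀ σ, Function.Periodic (F2 e φ0 φ1 σ) (2 * π) := fun σ θ => by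
    rw [eF2, eF2, p2]; simp only [bC, omega_per]
  have sK := contDiff_Kf sF1 sF2
  have cτ : ∀ s θ, Continuous (fun τ => Kf (F1 d φ0 φ1) (F2 e φ0 φ1) s θ τ) := fun s θ =>
    continuous_iff_continuousAt.2 fun τ => (hasDerivAt_Kf _ _ s θ τ).continuousAt
  -- case `F₁ ≠ 0`
  have main : ∀ s θ τ, 0 ≤ τ → τ < tau0 M d e φ0 φ1 → F1 d φ0 φ1 s θ ≠ 0 →
      0 < Kf (F1 d φ0 φ1) (F2 e φ0 φ1) s θ τ := by
    intro s θ τ h0 hτ hne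
    by_contra hcon
    rw [not_lt] at hcon
    obtain ⟨t, ht, ht0⟩ := intermediate_value_Icc' h0 (cτ s θ).continuousOn
      (show (0:ℝ) ∈ Set.Icc _ _ from ⟨hcon, by rw [Kf_zero]; exact zero_le_one⟩)
    beta_reduce at ht0
    have htpos : 0 < t := by
      rcases ht.1.lt_or_eq with h | h
      · exact h
      · rw [← h, Kf_zero] at ht0; norm_num at ht0
    obtain ⟨y, hy, hy2⟩ : ∃ y ∈ Set.Ico 0 (2 * π), ∃ n : ℤ, θ = y + n • (2 * π) := by
      obtain ⟨n, hn, -⟩ := existsUnique_add_zsmul_mem_Ico (show 0 < 2 * π by positivity) θ 0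
      refine ⟨θ + n • (2 * π), by simpa using hn, -n, by simp⟩
    obtain ⟨n, hn⟩ := hy2
    have hF1y : F1 d φ0 φ1 s θ = F1 d φ0 φ1 s y := by rw [hn]; exact (pF1 s).zsmul n y
    have hF2y : F2 e φ0 φ1 s θ = F2 e φ0 φ1 s y := by rw [hn]; exact (pF2 s).zsmul n y
    unfold Kf at ht0
    rw [hF1y] at hne
    rw [hF1y, hF2y] at ht0
    set f1 := F1 d φ0 φ1 s y with hf1
    set f2 := F2 e φ0 φ1 s y with hf2
    have hE := mul_Ef (t * f1)
    have hexp := Real.exp_pos (-(t * f1))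
    have hf2ne : f2 ≠ 0 := by
      intro h
      rw [h] at ht0; simp at ht0
    have key : Real.exp (-(t * f1)) * (f1 + f2) = f2 := by
      linear_combination f1 * ht0 + f2 * hE
    have key2 : 1 + f1 / f2 = Real.exp (t * f1) := by
      have : Real.exp (t * f1) * Real.exp (-(t * f1)) = 1 := by
        rw [← Real.exp_add]; simp
      have h1 : f2 + f1 = Real.exp (t * f1) * f2 := by
        linear_combination (-(f1 + f2)) * this + Real.exp (t * f1) * key
      have h2 : 1 + f1 / f2 = (f2 + f1) / f2 := by
        rw [add_div, div_self hf2ne]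
      rw [h2, h1, mul_div_assoc, div_self hf2ne, mul_one]
    have hG : G0 d e φ0 φ1 s y = t := by
      unfold G0
      rw [← hf1, ← hf2, key2, Real.log_exp]
      field_simp
    have hsM : s < M := by
      by_contra h
      rw [not_lt] at h
      apply hne
      rw [hf1, eF1, z1 s y h, mul_zero]
    have hB : (s, y) ∈ setB M d e φ0 φ1 := by
      refine ⟨⟨hsM, ⟨hy.1, hy.2.le⟩, hne, hf2ne, ?_⟩, ?_⟩
      · change 0 < 1 + f1 / f2
        rw [key2]; exact Real.exp_pos _
      · change 0 < G0 d e φ0 φ1 s y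
        rw [hG]; exact htpos
    have hle : tau0 M d e φ0 φ1 ≤ G0 d e φ0 φ1 s y := by
      refine csInf_le ⟨0, ?_⟩ ⟨(s, y), hB, rfl⟩
      rintro _ ⟨p, hp, rfl⟩
      exact hp.2.le
    rw [hG] at hle
    linarith [ht.2]
  by_cases hz : F1 d φ0 φ1 s θ = 0
  · by_contra hcon
    rw [not_lt] at hcon
    have hval : ∀ τ, Kf (F1 d φ0 φ1) (F2 e φ0 φ1) s θ τ = 1 - F2 e φ0 φ1 s θ * τ := by
      intro τ; simp [Kf, hz, Ef_zero]
    rw [hval] at hcon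
    have hF2 : 0 < F2 e φ0 φ1 s θ := by
      by_contra h
      rw [not_lt] at h
      nlinarith
    obtain ⟨τ', h1, h2⟩ := exists_between hτ
    have hneg : Kf (F1 d φ0 φ1) (F2 e φ0 φ1) s θ τ' < 0 := by
      rw [hval]; nlinarith
    have hcont : Continuous (fun p : ℝ × ℝ => Kf (F1 d φ0 φ1) (F2 e φ0 φ1) p.1 p.2 τ') :=
      sK.continuous.comp (continuous_fst.prodMk (continuous_snd.prodMk continuous_const))
    have hev : ∀ᶠ p : ℝ × ℝ in 𝓝 (s, θ), F1 d φ0 φ1 p.1 p.2 = 0 := by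
      have : ∀ᶠ p : ℝ × ℝ in 𝓝 (s, θ), Kf (F1 d φ0 φ1) (F2 e φ0 φ1) p.1 p.2 τ' < 0 :=
        (hcont.tendsto (s, θ)).eventually_lt_const hneg
      filter_upwards [this] with p hp
      by_contra hne
      exact absurd (main p.1 p.2 τ' (by linarith) h2 hne) (not_lt.2 hp.le)
    have hss : dS (dS (F0 φ0 φ1)) s θ ≠ 0 := by
      intro h
      rw [eF2, h, mul_zero] at hF2
      exact lt_irrefl _ hF2
    have hss' : ∀ᶠ x in 𝓝 θ, dS (dS (F0 φ0 φ1)) s x ≠ 0 := by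
      have : Continuous (fun x => dS (dS (F0 φ0 φ1)) s x) :=
        slice_cont (D := dS (dS (F0 φ0 φ1))) s2.continuous s
      exact this.continuousAt.eventually_ne hss
    rw [nhds_prod_eq] at hev
    have hev' : ∀ᶠ x in 𝓝 θ, ∀ᶠ σ in 𝓝 s, F1 d φ0 φ1 σ x = 0 := by
      obtain ⟨pa, hpa, pb, hpb, hab⟩ := Filter.eventually_prod_iff.1 hev
      filter_upwards [hpb] with x hx
      filter_upwards [hpa] with σ hσ
      exact hab hσ hx
    apply ha θ
    filter_upwards [hss', hev'] with x hx1 hx2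
    by_contra hax
    apply hx1
    have : (fun σ => dS (F0 φ0 φ1) σ x) =ᶠ[𝓝 s] fun _ => 0 := by
      filter_upwards [hx2] with σ hσ
      rw [eF1] at hσ
      exact (mul_eq_zero.1 hσ).resolve_left hax
    rw [dS, this.deriv_eq]; simp
  · exact main s θ τ h0 hτ hz

/-- Lemma 2.3: problem (2.1) admits a `C^∞` solution `V(q,ω,τ)` for `0 ≤ τ < τ₀`. -/
theorem profile_solution_exists
    (M : ℝ) (hM : 0 < M)
    (φ0 φ1 : ℝ × ℝ → ℝ)
    (hφ0 : ContDiff ℝ (⊤ : ℕ∞) φ0) (hφ1 : ContDiff ℝ (⊤ : ℕ∞) φ1)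
    (hs0 : SuppIn M φ0) (hs1 : SuppIn M φ1)
    (d : Fin 3 → Fin 3 → ℝ)
    (hdsymm : ∀ i j, d i j = d j i) (hd00 : d 0 0 = 0)
    (hdne : ∃ i j : Fin 3, (i, j) ≠ ((0 : Fin 3), (0 : Fin 3)) ∧ d i j ≠ 0)
    (e : Fin 3 → Fin 3 → Fin 3 → ℝ)
    (hnull : NullCondFails e)
    (hne : φ0 ≠ 0 ∨ φ1 ≠ 0) :
    ∃ V : ℝ → ℝ → ℝ → ℝ, IsProfileSol M d e φ0 φ1 (tau0 M d e φ0 φ1) V := by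
  have hF := field_F0 hM hφ0 hφ1 hs0 hs1
  by_cases hT : 0 < tau0 M d e φ0 φ1
  · have hap : ∀ θ, aC d (θ + 2 * π) = aC d θ := fun θ => by simp only [aC, omega_per]
    have hbp : ∀ θ, bC e (θ + 2 * π) = bC e θ := fun θ => by simp only [bC, omega_per]
    obtain ⟨V, h1, h2, h3, h4, h5⟩ := core hF (aC_smooth d) (bC_smooth e) hap hbp hT
      (fun s θ τ h0 h1 => Kf_pos hF d e (aC_not_locally_zero d hdsymm hd00 hdne) s θ τ h0 h1)
    refine ⟨V, h1, h2, h3, h4, fun q θ τ h0 hτ => ?_⟩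
    rw [h5 q θ τ h0 hτ]
    simp only [aC, bC, Fin.sum_univ_three]
    ring
  · refine ⟨fun q θ _ => F0 φ0 φ1 q θ, ?_, fun q θ _ => hF.per q θ, fun q θ _ h => hF.supp q θ h,
      fun _ _ => rfl, fun q θ τ h0 hτ => absurd (h0.trans_lt hτ) hT⟩
    intro p hp
    exact absurd (hp.1.trans_lt hp.2) hT
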